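/- Let d be a positive natural number and β > 0 a real number. For all vectors x, y in ℝ^d (with the Euclidean inner product ⟨·,·⟩ and norm |·|), one has ⟨|x|^β x − |y|^β y, x − y⟩ ≥ (1/2)(|x|^β + |y|^β)|x − y|². -/

import Mathlib

open scoped InnerProductSpace

/-- For `d > 0`, `β > 0` and vectors `x, y ∈ ℝ^d`,
`⟨|x|^β x − |y|^β y, x − y⟩ ≥ (1/2)(|x|^β + |y|^β)|x − y|²`. -/
theorem damping_monotonicity (d : ℕ) (hd : 0 < d) (β : ℝ) (hβ : 0 < β)
    (x y : EuclideanSpace ℝ (Fin d)) :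
    ⟪(‖x‖ ^ β) • x - (‖y‖ ^ β) • y, x - y⟫_ℝ ≥
      (1 / 2) * (‖x‖ ^ β + ‖y‖ ^ β) * ‖x - y‖ ^ 2 := by
  have key : 0 ≤ (‖x‖ ^ β - ‖y‖ ^ β) * (‖x‖ ^ 2 - ‖y‖ ^ 2) := by
    rcases le_total ‖x‖ ‖y‖ with h | h
    · have h1 := Real.rpow_le_rpow (norm_nonneg x) h hβ.le
      have h2 := pow_le_pow_left₀ (norm_nonneg x) h 2
      exact mul_nonneg_of_nonpos_of_nonpos (by linarith) (by linarith)
    · have h1 := Real.rpow_le_rpow (norm_nonneg y) h hβ.le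
      have h2 := pow_le_pow_left₀ (norm_nonneg y) h 2
      exact mul_nonneg (by linarith) (by linarith)
  rw [norm_sub_sq_real]
  simp only [inner_sub_left, inner_sub_right, real_inner_smul_left,
    real_inner_self_eq_norm_sq, real_inner_comm x y]
  generalize ‖x‖ ^ β = a at *
  generalize ‖y‖ ^ β = b at *
  try rw [real_inner_comm x y]
  nlinarith [key]
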